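/- arXiv:2110.15395 — 3 statements merged into one kernel-verified Lean document; each statement's English description precedes it below -/
import Mathlib

section
/- Every bad update decreases the potential h by exactly one: for every state s and every operation σ, if s' = apply s σ satisfies s' ≠ s and s' ≠ goodStep(s), then h(s') = h(s) − 1. -/
/-- Operations: confirm (•), append a bit, delete the last bit. -/
inductive Op where
  | confirm : Op
  | app : Bool → Op
  | del : Op
  deriving DecidableEq

/-- Apply an operation to a state `(yh, c)`. -/
def applyOp : List Bool × ℕ → Op → List Bool × ℕ
  | (yh, c), Op.confirm => (yh, c + 1)
  | (yh, c + 1), _ => (yh, c)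
  | (yh, 0), Op.app b => (yh ++ [b], 0)
  | (yh, 0), Op.del => (yh.dropLast, 0)

/-- The correct operation `op_y(yh)` with respect to the target string `y`. -/
def opy (y yh : List Bool) : Op :=
  if yh = y then Op.confirm
  else if h : yh.length < y.length ∧ yh <+: y then Op.app (y.get ⟨yh.length, h.1⟩)
  else Op.del

/-- The good step: apply the correct operation. -/
def goodStep (y : List Bool) (s : List Bool × ℕ) : List Bool × ℕ :=
  applyOp s (opy y s.1)

/-- Length of the longest common prefix of two boolean strings. -/
def lcp : List Bool → List Bool → ℕ
  | a :: as, b :: bs => if a = b then lcp as bs + 1 else 0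
  | _, _ => 0

/-- The potential `h(yh, c)`. -/
def pot (y : List Bool) (s : List Bool × ℕ) : ℤ :=
  if s.1 = y then (y.length : ℤ) + s.2
  else 2 * (lcp s.1 y : ℤ) - s.1.length - s.2

theorem lcp_of_prefix {u v : List Bool} (h : u <+: v) : lcp u v = u.length := by
  induction u generalizing v with
  | nil => simp [lcp]
  | cons a u ih =>
    obtain ⟨t, rfl⟩ := h
    simp [lcp, ih (List.prefix_append u t)]

theorem lcp_append_of_not_prefix {u v : List Bool} {b : Bool} (h : ¬ u ++ [b] <+: v) :
    lcp (u ++ [b]) v = lcp u v := by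
  induction u generalizing v with
  | nil => cases v <;> simp_all [lcp]
  | cons a u ih =>
    cases v with
    | nil => simp [lcp]
    | cons d v =>
      by_cases had : a = d
      · subst had
        simp only [List.cons_append, List.cons_prefix_cons, true_and] at h
        simp [lcp, ih h]
      · simp [lcp, had]

theorem pot_of_prefix {u y : List Bool} (h : u <+: y) : pot y (u, 0) = u.length := by
  unfold pot
  split_ifs with hu
  · simp_all
  · simp only [lcp_of_prefix h]
    push_cast
    ring

theorem pot_append_of_not_prefix {u y : List Bool} {b : Bool} (h : ¬ u ++ [b] <+: y) :
    pot y (u ++ [b], 0) = pot y (u, 0) - 1 := by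
  have hne : u ++ [b] ≠ y := fun e => h (e ▸ List.prefix_refl _)
  by_cases hu : u = y
  · subst hu
    simp [pot, lcp_append_of_not_prefix h, lcp_of_prefix (List.prefix_refl u)]
    ring
  · simp [pot, hne, hu, lcp_append_of_not_prefix h]
    ring

theorem opy_of_append_prefix {u y : List Bool} {b : Bool} (h : u ++ [b] <+: y) :
    opy y u = Op.app b := by
  obtain ⟨t, rfl⟩ := h
  simp [opy]

theorem opy_of_not_prefix {u y : List Bool} (h : ¬ u <+: y) : opy y u = Op.del := by
  have hne : u ≠ y := fun e => h (e ▸ List.prefix_refl _)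
  simp [opy, hne, h]

theorem opy_eq_confirm_iff {u y : List Bool} : opy y u = Op.confirm ↔ u = y := by
  unfold opy
  split_ifs <;> simp_all

theorem applyOp_succ_of_ne_confirm (u : List Bool) (c : ℕ) {σ : Op} (h : σ ≠ Op.confirm) :
    applyOp (u, c + 1) σ = (u, c) := by
  cases σ <;> simp_all [applyOp]

/-- Every bad update decreases the potential `h` by exactly one. -/
theorem pot_bad_update (y : List Bool) (hn : 1 ≤ y.length)
    (s : List Bool × ℕ) (σ : Op)
    (hne : applyOp s σ ≠ s) (hbad : applyOp s σ ≠ goodStep y s) :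
    pot y (applyOp s σ) = pot y s - 1 := by
  obtain ⟨u, c⟩ := s
  by_cases hσ : σ = Op.confirm
  · subst hσ
    have hu : u ≠ y := by
      intro e
      simp [goodStep, opy_eq_confirm_iff.2 e] at hbad
    simp only [applyOp, pot, hu, if_false]
    push_cast
    ring
  cases c with
  | succ c =>
    have hu : u = y := by
      by_contra e
      apply hbad
      rw [goodStep, applyOp_succ_of_ne_confirm u c hσ,
        applyOp_succ_of_ne_confirm u c (mt opy_eq_confirm_iff.1 e)]
    rw [applyOp_succ_of_ne_confirm u c hσ]
    simp only [pot, hu, if_true]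
    push_cast
    ring
  | zero =>
    cases σ with
    | confirm => exact absurd rfl hσ
    | app b =>
      apply pot_append_of_not_prefix
      intro h
      simp [goodStep, opy_of_append_prefix h] at hbad
    | del =>
      have hu : u <+: y := by
        by_contra h
        simp [goodStep, opy_of_not_prefix h] at hbad
      have hnil : u ≠ [] := by
        rintro rfl
        simp [applyOp] at hne
      have hpos := List.length_pos_iff.2 hnil
      simp only [applyOp]
      rw [pot_of_prefix hu, pot_of_prefix ((List.dropLast_prefix u).trans hu),
        List.length_dropLast]
      omega
end

section
/- For every update sequence s₀, s₁, …, s_m starting from the initial state s₀ = (∅, 0), the number g of good updates minus the number b of bad updates in the sequence equals the potential of the final state: g − b = h(s_m). -/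
theorem lcp_append_singleton (x y : List Bool) (b : Bool) :
    lcp (x ++ [b]) y =
      if lcp x y = x.length ∧ y[x.length]? = some b then lcp x y + 1 else lcp x y := by
  induction x generalizing y with
  | nil => cases y <;> simp [lcp, eq_comm]
  | cons a x ih =>
    cases y with
    | nil => simp [lcp]
    | cons c y =>
      by_cases h : a = c
      · simp only [List.cons_append, lcp, h, if_true, ih, List.length_cons, Nat.add_right_cancel_iff,
          List.getElem?_cons_succ]
        split_ifs <;> rfl
      · simp [lcp, h]

theorem prefix_iff_lcp_eq_length (x y : List Bool) : x <+: y ↔ lcp x y = x.length := by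
  induction x generalizing y with
  | nil => cases y <;> simp [lcp]
  | cons a x ih =>
    cases y with
    | nil => simp [lcp]
    | cons c y =>
      by_cases h : a = c
      · simp [lcp, h, List.cons_prefix_cons, ih]
      · simp [lcp, h, List.cons_prefix_cons]

theorem lcp_le_length_left (x y : List Bool) : lcp x y ≤ x.length := by
  induction x generalizing y with
  | nil => cases y <;> simp [lcp]
  | cons a x ih =>
    cases y with
    | nil => simp [lcp]
    | cons c y =>
      have := ih y
      by_cases h : a = c <;> simp [lcp, h, this]

theorem lcp_self (y : List Bool) : lcp y y = y.length :=
  (prefix_iff_lcp_eq_length y y).1 List.prefix_rfl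

theorem pot_zero (y x : List Bool) : pot y (x, 0) = 2 * (lcp x y : ℤ) - x.length := by
  unfold pot
  split_ifs with h
  · have h' : x = y := h
    subst h'
    simp only [lcp_self]
    push_cast
    ring
  · simp

theorem opy_self (y : List Bool) : opy y y = Op.confirm := by simp [opy]

theorem opy_ne_confirm {y x : List Bool} (h : x ≠ y) : opy y x ≠ Op.confirm := by
  unfold opy
  split_ifs <;> simp_all

theorem opy_eq_app_iff {y x : List Bool} {b : Bool} :
    opy y x = Op.app b ↔ lcp x y = x.length ∧ y[x.length]? = some b := by
  unfold opy
  split_ifs with h h'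
  · simp [h]
  · have := (prefix_iff_lcp_eq_length x y).1 h'.2
    simp [this, h'.1]
  · rw [← prefix_iff_lcp_eq_length]
    simp only [false_iff, not_and]
    intro hp hb
    exact h' ⟨(List.getElem?_eq_some_iff.1 hb).1, hp⟩

theorem opy_eq_del_iff {y x : List Bool} : opy y x = Op.del ↔ lcp x y ≠ x.length := by
  rw [Ne, ← prefix_iff_lcp_eq_length]
  unfold opy
  split_ifs with h h'
  · simp [h]
  · simp [h'.2]
  · simp only [true_iff]
    intro hp
    exact h' ⟨lt_of_le_of_ne hp.length_le fun hl => h (hp.eq_of_length hl), hp⟩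

theorem applyOp_succ {x : List Bool} {c : ℕ} {σ : Op} (h : σ ≠ Op.confirm) :
    applyOp (x, c + 1) σ = (x, c) := by
  cases σ <;> simp_all [applyOp]

theorem applyOp_zero_injective_of_ne {x : List Bool} {σ τ : Op}
    (hne : applyOp (x, 0) σ ≠ (x, 0)) (h : applyOp (x, 0) σ = applyOp (x, 0) τ) : σ = τ := by
  have hlen := congrArg (fun s => s.1.length) h
  cases σ <;> cases τ <;> simp [applyOp] at h hlen ⊢
  · exact h
  all_goals omega

theorem pot_applyOp_zero (y x : List Bool) (σ : Op)
    (hne : applyOp (x, 0) σ ≠ (x, 0)) :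
    pot y (applyOp (x, 0) σ) = pot y (x, 0) + if σ = opy y x then 1 else -1 := by
  cases σ with
  | confirm =>
    by_cases h : x = y
    · simp [applyOp, pot, h, opy_self]
    · rw [if_neg (opy_ne_confirm h).symm]
      simp [applyOp, pot, h]
      ring
  | app b =>
    simp only [applyOp, pot_zero, lcp_append_singleton, eq_comm (a := Op.app b), opy_eq_app_iff]
    split_ifs <;> push_cast [List.length_append, List.length_singleton] <;> ring
  | del =>
    rcases List.eq_nil_or_concat' x with rfl | ⟨z, b, rfl⟩
    · simp [applyOp] at hne
    · have hle := lcp_le_length_left z y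
      simp only [applyOp, pot_zero, eq_comm (a := Op.del), opy_eq_del_iff, List.dropLast_concat,
        lcp_append_singleton, List.length_append, List.length_singleton]
      split_ifs <;> push_cast <;> omega

theorem pot_applyOp (y : List Bool) (s : List Bool × ℕ) (σ : Op)
    (hne : applyOp s σ ≠ s) :
    pot y (applyOp s σ) = pot y s + if applyOp s σ = goodStep y s then 1 else -1 := by
  obtain ⟨x, _ | c⟩ := s
  · rw [pot_applyOp_zero y x σ hne]
    congr 2
    exact propext ⟨fun h => h ▸ rfl, applyOp_zero_injective_of_ne hne⟩
  · unfold goodStep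
    by_cases hx : x = y
    · subst hx
      rw [opy_self]
      by_cases hσ : σ = Op.confirm
      · subst hσ
        simp [applyOp, pot, add_assoc]
      · rw [applyOp_succ hσ]
        simp [applyOp, pot, add_assoc]
    · rw [applyOp_succ (opy_ne_confirm hx)]
      by_cases hσ : σ = Op.confirm
      · subst hσ
        simp [applyOp, pot, hx, add_assoc]
        ring
      · rw [applyOp_succ hσ]
        simp [pot, hx]
        ring

/-- For an update sequence starting at `([], 0)`, the number of good updates minus the
number of bad updates equals the potential of the final state. -/
theorem good_minus_bad_eq_pot (y : List Bool) (hn : 1 ≤ y.length)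
    (m : ℕ) (s : ℕ → List Bool × ℕ)
    (h0 : s 0 = ([], 0))
    (hupd : ∀ i < m, (∃ σ, s (i + 1) = applyOp (s i) σ) ∧ s (i + 1) ≠ s i)
    (g : ℕ)
    (hg : g = ((Finset.range m).filter (fun i => s (i + 1) = goodStep y (s i))).card)
    (b : ℕ) (hb : b = m - g) :
    (g : ℤ) - (b : ℤ) = pot y (s m) := by
  have key : ∀ k ≤ m, pot y (s k) =
      ∑ i ∈ Finset.range k, if s (i + 1) = goodStep y (s i) then (1 : ℤ) else -1 := by
    intro k
    induction k with
    | zero =>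
      intro _
      rw [h0, pot_zero, Finset.sum_range_zero]
      cases y <;> simp [lcp]
    | succ k ih =>
      intro hk
      obtain ⟨⟨σ, hσ⟩, hne⟩ := hupd k hk
      rw [Finset.sum_range_succ, ← ih (Nat.le_of_succ_le hk), hσ]
      exact pot_applyOp y (s k) σ (hσ ▸ hne)
  have hle : g ≤ m := hg ▸ (Finset.card_filter_le _ _).trans (Finset.card_range m).le
  have hcard := Finset.card_filter_add_card_filter_not (s := Finset.range m)
    (fun i => s (i + 1) = goodStep y (s i))
  rw [← hg, Finset.card_range] at hcard
  rw [key m le_rfl, Finset.sum_ite, Finset.sum_const, Finset.sum_const, ← hg]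
  simp only [nsmul_eq_mul]
  omega
end

section
/- The quantity D(s) is exactly the number of good updates needed to reach the target: for every state s, the D(s)-fold iterate of goodStep applied to s has first component equal to y, and for every k < D(s) the k-fold iterate of goodStep applied to s has first component different from y. -/
/-- `D(yh, c)`: the number of good updates needed to reach the target. -/
def D (y : List Bool) (s : List Bool × ℕ) : ℕ :=
  if s.1 = y then 0
  else s.2 + (s.1.length - lcp s.1 y) + (y.length - lcp s.1 y)

theorem lcp_le_length_left_s7 (a b : List Bool) : lcp a b ≤ a.length := by
  induction a generalizing b with
  | nil => simp [lcp]
  | cons x a ih =>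
    cases b with
    | nil => simp [lcp]
    | cons z b =>
      have := ih b
      simp only [lcp, List.length_cons]
      split <;> omega

theorem lcp_le_length_right (a b : List Bool) : lcp a b ≤ b.length := by
  induction a generalizing b with
  | nil => simp [lcp]
  | cons x a ih =>
    cases b with
    | nil => simp [lcp]
    | cons z b =>
      have := ih b
      simp only [lcp, List.length_cons]
      split <;> omega

theorem lcp_eq_length_left_iff (a b : List Bool) : lcp a b = a.length ↔ a <+: b := by
  induction a generalizing b with
  | nil => simp [lcp]
  | cons x a ih =>
    cases b with
    | nil => simp [lcp]
    | cons z b =>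
      simp only [lcp, List.length_cons, List.cons_prefix_cons, ← ih b]
      split <;> simp_all

theorem lcp_dropLast_of_not_prefix {a b : List Bool} (h : ¬ a <+: b) :
    lcp a.dropLast b = lcp a b := by
  induction a generalizing b with
  | nil => simp
  | cons x a ih =>
    cases b with
    | nil => cases a <;> simp [lcp]
    | cons z b =>
      rw [List.cons_prefix_cons, not_and] at h
      cases a with
      | nil => simp_all [lcp]
      | cons w a =>
        by_cases hxz : x = z
        · have := ih (h hxz)
          rw [List.dropLast_cons_cons, lcp, lcp, this]
        · simp [lcp, hxz]

theorem D_eq_zero_iff (y : List Bool) (s : List Bool × ℕ) : D y s = 0 ↔ s.1 = y := by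
  refine ⟨fun h => ?_, fun h => by simp [D, h]⟩
  by_contra hne
  have hl := lcp_le_length_left_s7 s.1 y
  have hr := lcp_le_length_right s.1 y
  simp only [D, if_neg hne] at h
  exact hne (((lcp_eq_length_left_iff s.1 y).1 (by omega)).eq_of_length (by omega))

theorem D_zero_confirmations (y yh : List Bool) :
    D y (yh, 0) = (yh.length - lcp yh y) + (y.length - lcp yh y) := by
  by_cases h : yh = y
  · subst h
    have := (lcp_eq_length_left_iff yh yh).2 List.prefix_rfl
    simp [D, this]
  · simp [D, h]

theorem D_goodStep_add_one {y : List Bool} {s : List Bool × ℕ} (h : s.1 ≠ y) :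
    D y (goodStep y s) + 1 = D y s := by
  obtain ⟨yh, c⟩ := s
  change yh ≠ y at h
  have hl := lcp_le_length_left_s7 yh y
  have hr := lcp_le_length_right yh y
  cases c with
  | succ c =>
    have hstep : goodStep y (yh, c + 1) = (yh, c) := by
      simp only [goodStep, opy, if_neg h]
      split <;> rfl
    simp only [hstep, D, if_neg h]
    omega
  | zero =>
    by_cases hp : yh <+: y
    · have hlt : yh.length < y.length :=
        lt_of_le_of_ne hp.length_le fun he => h (hp.eq_of_length he)
      have hstep : goodStep y (yh, 0) = (yh ++ [y[yh.length]], 0) := by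
        simp [goodStep, opy, h, hp, hlt, applyOp]
      have hp' : yh ++ [y[yh.length]] <+: y := by
        have := List.take_prefix (yh.length + 1) y
        rwa [List.take_succ_eq_append_getElem hlt, ← List.prefix_iff_eq_take.1 hp] at this
      have h1 := (lcp_eq_length_left_iff _ _).2 hp
      have h2 := (lcp_eq_length_left_iff _ _).2 hp'
      rw [hstep, D_zero_confirmations, D_zero_confirmations, h1, h2]
      simp only [List.length_append, List.length_singleton]
      omega
    · have hstep : goodStep y (yh, 0) = (yh.dropLast, 0) := by
        simp [goodStep, opy, h, hp, applyOp]
      have h1 : lcp yh y ≠ yh.length := mt (lcp_eq_length_left_iff _ _).1 hp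
      have h2 := lcp_le_length_left_s7 yh.dropLast y
      rw [lcp_dropLast_of_not_prefix hp] at h2
      rw [hstep, D_zero_confirmations, D_zero_confirmations, lcp_dropLast_of_not_prefix hp]
      simp only [List.length_dropLast] at h2 ⊢
      omega

theorem D_iterate_goodStep (y : List Bool) (s : List Bool × ℕ) {k : ℕ} (hk : k ≤ D y s) :
    D y ((goodStep y)^[k] s) = D y s - k := by
  induction k with
  | zero => rfl
  | succ k ih =>
    have hD := ih (by omega)
    have hne : ((goodStep y)^[k] s).1 ≠ y := by
      rw [ne_eq, ← D_eq_zero_iff]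
      omega
    have := D_goodStep_add_one hne
    rw [Function.iterate_succ_apply']
    omega

/-- `D(s)` is exactly the number of good updates needed to reach the target. -/
theorem D_eq_good_updates_needed (y : List Bool) (hn : 1 ≤ y.length)
    (s : List Bool × ℕ) :
    ((goodStep y)^[D y s] s).1 = y ∧ ∀ k < D y s, ((goodStep y)^[k] s).1 ≠ y := by
  refine ⟨?_, fun k hk => ?_⟩
  · rw [← D_eq_zero_iff, D_iterate_goodStep y s le_rfl, Nat.sub_self]
  · rw [ne_eq, ← D_eq_zero_iff, D_iterate_goodStep y s hk.le]
    omega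
end
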